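/- arXiv:2403.05367 — 3 statements merged into one kernel-verified Lean document; each statement's English description precedes it below -/
import Mathlib

section
/- Let F ∈ ℝ^{n_w×n_w}, λ ∈ ℝ, M ∈ ℝ^{(n+m)×n_w} and Θ ∈ ℝ^{(n+m)×n}, and assume that F ⊗ F − λ I_{n_w²} is invertible. If Π_H ∈ ℝ^{(n+m)²×n_w²} and Π_S ∈ ℝ^{(n+m)n×n_w²} satisfy the Sylvester equations Π_H (F ⊗ F) = λ Π_H + M ⊗ M and Π_S (F ⊗ F) = λ Π_S + (ΘᵀM) ⊗ M, then (Θᵀ ⊗ I_{n+m}) Π_H = Π_S. -/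
open scoped Kronecker Matrix

/-- If `F ⊗ F − λ I` is invertible and `Π_H`, `Π_S` solve the two Sylvester equations
`Π_H (F ⊗ F) = λ Π_H + M ⊗ M` and `Π_S (F ⊗ F) = λ Π_S + (ΘᵀM) ⊗ M`, then
`(Θᵀ ⊗ I) Π_H = Π_S`. -/
theorem stmt_2 {n m nw : ℕ} (F : Matrix (Fin nw) (Fin nw) ℝ) (lam : ℝ)
    (M : Matrix (Fin n ⊕ Fin m) (Fin nw) ℝ)
    (Theta : Matrix (Fin n ⊕ Fin m) (Fin n) ℝ)
    (hinv : IsUnit (F ⊗ₖ F - lam • (1 : Matrix (Fin nw × Fin nw) (Fin nw × Fin nw) ℝ)))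
    (PiH : Matrix ((Fin n ⊕ Fin m) × (Fin n ⊕ Fin m)) (Fin nw × Fin nw) ℝ)
    (PiS : Matrix (Fin n × (Fin n ⊕ Fin m)) (Fin nw × Fin nw) ℝ)
    (hH : PiH * (F ⊗ₖ F) = lam • PiH + M ⊗ₖ M)
    (hS : PiS * (F ⊗ₖ F) = lam • PiS + (Thetaᵀ * M) ⊗ₖ M) :
    (Thetaᵀ ⊗ₖ (1 : Matrix (Fin n ⊕ Fin m) (Fin n ⊕ Fin m) ℝ)) * PiH = PiS := by
  have key : ((Thetaᵀ ⊗ₖ (1 : Matrix (Fin n ⊕ Fin m) (Fin n ⊕ Fin m) ℝ)) * PiH)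
      * (F ⊗ₖ F - lam • (1 : Matrix (Fin nw × Fin nw) (Fin nw × Fin nw) ℝ))
      = PiS * (F ⊗ₖ F - lam • (1 : Matrix (Fin nw × Fin nw) (Fin nw × Fin nw) ℝ)) := by
    rw [Matrix.mul_sub, Matrix.mul_sub, Matrix.mul_assoc, hH, hS, Matrix.mul_add,
      ← Matrix.mul_kronecker_mul, Matrix.one_mul, Matrix.mul_smul, Matrix.mul_smul,
      Matrix.mul_smul, Matrix.mul_one, Matrix.mul_one, add_sub_cancel_left, add_sub_cancel_left]
  obtain ⟨u, hu⟩ := hinv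
  rw [← hu] at key
  have h := congrArg (fun X => X * (↑u⁻¹ : Matrix (Fin nw × Fin nw) (Fin nw × Fin nw) ℝ)) key
  simp only [Matrix.mul_assoc _ (u : Matrix (Fin nw × Fin nw) (Fin nw × Fin nw) ℝ) _,
    Units.mul_inv, Matrix.mul_one] at h
  exact h
end

section
/- Let (w_t)_{t∈ℕ} be a sequence in ℝ^{n_w} such that there exist α₁ > 0 and t_w ∈ ℕ, t_w ≥ 1, with α₁ I_{n_w} ≼ Σ_{τ=t̄+1}^{t̄+t_w} w_τ w_τᵀ for all t̄ ∈ ℕ, and let λ ∈ (0,1). Then for every t ≥ t_w + 1, the matrix Σ_{τ=0}^{t−1} λ^{t−1−τ} w_τ w_τᵀ is symmetric positive definite. -/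
open scoped Matrix

/-- If the sequence `(w_t)` is persistently exciting in the sense that the windowed Gram
matrices are uniformly bounded below by `α₁ I`, and `λ ∈ (0,1)`, then the exponentially
weighted Gram matrix `Σ_{τ=0}^{t−1} λ^{t−1−τ} w_τ w_τᵀ` is symmetric positive definite
for every `t ≥ t_w + 1`. -/
theorem stmt_9 {nw : ℕ} (w : ℕ → Fin nw → ℝ) (α₁ : ℝ) (hα₁ : 0 < α₁)
    (tw : ℕ) (htw : 1 ≤ tw)
    (hpe : ∀ tbar : ℕ,
      ((∑ τ ∈ Finset.Icc (tbar + 1) (tbar + tw), Matrix.vecMulVec (w τ) (w τ))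
        - α₁ • (1 : Matrix (Fin nw) (Fin nw) ℝ)).PosSemidef)
    (lam : ℝ) (hlam : lam ∈ Set.Ioo (0 : ℝ) 1) :
    ∀ t : ℕ, tw + 1 ≤ t →
      (∑ τ ∈ Finset.range t, lam ^ (t - 1 - τ) • Matrix.vecMulVec (w τ) (w τ)).PosDef := by
  intro t ht
  obtain ⟨h0, h1⟩ := hlam
  have key : ∀ (τ : ℕ) (x : Fin nw → ℝ),
      x ⬝ᵥ (Matrix.vecMulVec (w τ) (w τ) *ᵥ x) = (w τ ⬝ᵥ x) ^ 2 := by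
    intro τ x
    rw [Matrix.vecMulVec_mulVec]
    simp [dotProduct_comm x (w τ), sq]
  apply Matrix.PosDef.of_dotProduct_mulVec_pos
  · unfold Matrix.IsHermitian
    rw [Matrix.conjTranspose_sum]
    refine Finset.sum_congr rfl fun τ _ => ?_
    ext i j
    simp [Matrix.vecMulVec_apply, mul_comm]
  · intro x hx
    have hxx : 0 < x ⬝ᵥ x := by
      have := Matrix.dotProduct_star_self_pos_iff.mpr hx
      simpa using this
    have hp := (hpe 0).dotProduct_mulVec_nonneg x
    simp only [star_trivial, Matrix.sub_mulVec, Matrix.sum_mulVec, Matrix.smul_mulVec,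
      Matrix.one_mulVec, dotProduct_sub, dotProduct_sum, dotProduct_smul, key, smul_eq_mul,
      zero_add] at hp ⊢
    have hpos : 0 < ∑ τ ∈ Finset.Icc 1 tw, (w τ ⬝ᵥ x) ^ 2 := by
      have := mul_pos hα₁ hxx
      linarith
    obtain ⟨τ, hτ, hτp⟩ := Finset.exists_lt_of_sum_lt
      (s := Finset.Icc 1 tw) (f := fun _ => (0 : ℝ)) (g := fun τ => (w τ ⬝ᵥ x) ^ 2)
      (by simpa using hpos)
    refine Finset.sum_pos' (fun i _ => by positivity) ⟨τ, ?_, ?_⟩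
    · simp only [Finset.mem_Icc] at hτ
      simp only [Finset.mem_range]
      omega
    · exact mul_pos (pow_pos h0 _) hτp
end

section
/- Let F ∈ ℝ^{n_w×n_w}, M ∈ ℝ^{p×n_w}, λ ∈ ℝ, w₀ ∈ ℝ^{n_w}, and set w_t := F^t w₀. Suppose Π_H ∈ ℝ^{p²×n_w²} satisfies Π_H (F ⊗ F) = λ Π_H + M ⊗ M, and define H^{ss}_t := unvec_{p×p}(Π_H vec(w_t w_tᵀ)). If (H_t)_{t∈ℕ} is any sequence of p×p real matrices satisfying H_{t+1} = λ H_t + M w_t w_tᵀ Mᵀ, then H_t − H^{ss}_t = λ^t (H₀ − H^{ss}₀) for all t ∈ ℕ; in particular, if λ ∈ (0,1) then ‖H_t − H^{ss}_t‖ ≤ λ^t ‖H₀ − H^{ss}₀‖ for all t. -/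
open scoped Kronecker Matrix

attribute [local instance] Matrix.normedAddCommGroup

/-- Column-stacking vectorization, with the index convention making
`vec (A * X * B) = (Bᵀ ⊗ A).mulVec (vec X)` hold. -/
def vec {p q : Type*} (X : Matrix p q ℝ) : q × p → ℝ := fun ji => X ji.2 ji.1

/-- Inverse of the column-stacking vectorization. -/
def unvec {p q : Type*} (v : q × p → ℝ) : Matrix p q ℝ := Matrix.of fun i j => v (j, i)

theorem vec_aux {p q r : ℕ} (A : Matrix (Fin p) (Fin q) ℝ) (B : Matrix (Fin r) (Fin q) ℝ)
    (X : Matrix (Fin q) (Fin q) ℝ) :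
    (B ⊗ₖ A).mulVec (vec X) = vec (A * X * Bᵀ) :=
  Matrix.kronecker_mulVec_vec A X B

/-- The deviation of the recursion `H_{t+1} = λ H_t + M w_t w_tᵀ Mᵀ` from its
steady-state `H^{ss}_t := unvec (Π_H vec(w_t w_tᵀ))` contracts exactly by `λ` at each
step; in particular it decays geometrically in norm when `λ ∈ (0,1)`. -/
theorem stmt_10 {p nw : ℕ} (F : Matrix (Fin nw) (Fin nw) ℝ)
    (M : Matrix (Fin p) (Fin nw) ℝ) (lam : ℝ) (w0 : Fin nw → ℝ)
    (PiH : Matrix ((Fin p) × (Fin p)) (Fin nw × Fin nw) ℝ)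
    (hPiH : PiH * (F ⊗ₖ F) = lam • PiH + M ⊗ₖ M)
    (H : ℕ → Matrix (Fin p) (Fin p) ℝ)
    (hH : ∀ t : ℕ, H (t + 1)
      = lam • H t + M * Matrix.vecMulVec ((F ^ t).mulVec w0) ((F ^ t).mulVec w0) * Mᵀ)
    (Hss : ℕ → Matrix (Fin p) (Fin p) ℝ)
    (hHss : ∀ t : ℕ, Hss t
      = unvec (PiH.mulVec (vec (Matrix.vecMulVec ((F ^ t).mulVec w0) ((F ^ t).mulVec w0))))) :
    (∀ t : ℕ, H t - Hss t = lam ^ t • (H 0 - Hss 0)) ∧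
    (lam ∈ Set.Ioo (0 : ℝ) 1 → ∀ t : ℕ, ‖H t - Hss t‖ ≤ lam ^ t * ‖H 0 - Hss 0‖) := by
  have key : ∀ t : ℕ, Hss (t + 1)
      = lam • Hss t + M * Matrix.vecMulVec ((F ^ t).mulVec w0) ((F ^ t).mulVec w0) * Mᵀ := by
    intro t
    have h1 : Matrix.vecMulVec ((F ^ (t + 1)).mulVec w0) ((F ^ (t + 1)).mulVec w0)
        = F * Matrix.vecMulVec ((F ^ t).mulVec w0) ((F ^ t).mulVec w0) * Fᵀ := by
      rw [Matrix.mul_vecMulVec, Matrix.vecMulVec_mul, Matrix.vecMul_transpose,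
        Matrix.mulVec_mulVec, pow_succ']
    rw [hHss, hHss, h1, ← vec_aux, Matrix.mulVec_mulVec, hPiH, Matrix.add_mulVec,
      Matrix.smul_mulVec, vec_aux]
    rfl
  have main : ∀ t : ℕ, H t - Hss t = lam ^ t • (H 0 - Hss 0) := by
    intro t
    induction t with
    | zero => simp
    | succ t ih =>
      rw [hH, key, add_sub_add_right_eq_sub, ← smul_sub, ih, smul_smul, pow_succ']
  refine ⟨main, fun hl t => ?_⟩
  letI := Matrix.normedSpace (R := ℝ) (m := Fin p) (n := Fin p) (α := ℝ)
  rw [main t]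
  refine (norm_smul_le _ _).trans ?_
  rw [Real.norm_of_nonneg (pow_nonneg hl.1.le t)]
end
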